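/- Let E be a directed graph, let d_r be a Drinen range-vector for E, and let d_r(E) be the in-delayed graph. Then the saturation in d_r(E) of the set S = {v_0 : v ∈ E^0} is all of d_r(E)^0, i.e. ΣH(S) = d_r(E)^0. -/

import Mathlib

/-! Statement 6: the saturation of `{v_0 : v ∈ E^0}` in an in-delayed graph is the
whole vertex set. -/

section Saturation

variable {V E : Type} (r s : E → V)

/-- One step along an edge: there is an edge from `u` to `v`. -/
def Step (u v : V) : Prop := ∃ e, s e = u ∧ r e = v

/-- `Σ₀(S)`: the set of vertices reachable by a finite path (possibly of length zero)
from a vertex of `S`. -/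
def Sigma0 (S : Set V) : Set V :=
  {v | ∃ u ∈ S, Relation.ReflTransGen (Step r s) u v}

/-- The sets `Σₙ(S)` defined inductively: `Σₙ₊₁(S)` adds to `Σₙ(S)` every vertex `w`
emitting at least one and only finitely many edges, all of whose ranges lie in
`Σₙ(S)`. -/
def SigmaN (S : Set V) : ℕ → Set V
  | 0 => Sigma0 r s S
  | n + 1 => SigmaN S n ∪
      {w | {e | s e = w}.Nonempty ∧ {e | s e = w}.Finite ∧
        ∀ e, s e = w → r e ∈ SigmaN S n}

/-- The saturation `ΣH(S) = ⋃ₙ Σₙ(S)`. -/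
def SigmaH (S : Set V) : Set V := ⋃ n, SigmaN r s S n

end Saturation

section InDelay

variable {V E : Type} (r s : E → V) (d : V → ℕ∞) (dE : E → ℕ)

/-- Vertices of the in-delayed graph `d_r(E)`: pairs `v_i = (v, i)` with
`0 ≤ i ≤ d_r v`. -/
def IDVert : Type := {p : V × ℕ // (p.2 : ℕ∞) ≤ d p.1}

/-- Edges of the in-delayed graph: the original edges `e ∈ E^1` together with the
delay edges `f(v)_i`, `1 ≤ i ≤ d_r v`, encoded as pairs `(v, i)`. -/
def IDEdge (E : Type) {V : Type} (d : V → ℕ∞) : Type :=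
  E ⊕ {p : V × ℕ // 1 ≤ p.2 ∧ (p.2 : ℕ∞) ≤ d p.1}

/-- The vertex `v_0` of the in-delayed graph. -/
def idVert0 (v : V) : IDVert d := ⟨(v, 0), by simp⟩

/-- The source map of the in-delayed graph: `s(e) = s(e)_0` and `s(f(v)_i) = v_i`. -/
def idSrc : IDEdge E d → IDVert d
  | .inl e => idVert0 d (s e)
  | .inr g => ⟨g.1, g.2.2⟩

/-- The range map of the in-delayed graph: `r(e) = r(e)_{d_r e}` and
`r(f(v)_i) = v_{i-1}`.  (The hypothesis `hrd`, that `d_r e ≤ d_r (r e)`, is a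
consequence of the definition of a Drinen range-vector.) -/
def idRng (hrd : ∀ e, (dE e : ℕ∞) ≤ d (r e)) : IDEdge E d → IDVert d
  | .inl e => ⟨(r e, dE e), hrd e⟩
  | .inr g => ⟨(g.1.1, g.1.2 - 1), le_trans (by exact_mod_cast Nat.sub_le _ _) g.2.2⟩

end InDelay

theorem idVert_mem_SigmaN {V E : Type} (r s : E → V) (d : V → ℕ∞) (dE : E → ℕ)
    (hrd : ∀ e, (dE e : ℕ∞) ≤ d (r e)) (v : V) (i : ℕ) (hi : (i : ℕ∞) ≤ d v) :
    (⟨(v, i), hi⟩ : IDVert d) ∈ SigmaN (idRng r d dE hrd) (idSrc s d)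
      {w : IDVert d | ∃ v : V, w = idVert0 d v} i := by
  induction i with
  | zero => exact ⟨_, ⟨v, rfl⟩, Relation.ReflTransGen.refl⟩
  | succ i ih =>
    have h_src : ∀ e : IDEdge E d, idSrc s d e = ⟨(v, i + 1), hi⟩ →
        e = Sum.inr ⟨(v, i + 1), Nat.le_add_left 1 i, hi⟩ := by
      rintro (e | ⟨⟨u, j⟩, hj⟩) he
      · have h0 : 0 = i + 1 := congrArg (fun w : IDVert d => w.1.2) he
        omega
      · have hp : (u, j) = (v, i + 1) := congrArg Subtype.val he
        cases hp
        rfl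
    refine Or.inr ⟨⟨Sum.inr ⟨(v, i + 1), Nat.le_add_left 1 i, hi⟩, rfl⟩,
      (Set.finite_singleton _).subset h_src, fun e he => ?_⟩
    rw [h_src e he]
    exact ih (le_trans (by exact_mod_cast Nat.le_succ i) hi)

/-- Let `E` be a directed graph (countable vertex and edge sets) and
`d_r` a Drinen range-vector for `E` (vertex part `d : V → ℕ∞`, edge part `dE : E → ℕ`;
the hypothesis `hrd` is the consequence `d_r e ≤ d_r (r e)` of axiom (i)).  Then the
saturation in the in-delayed graph `d_r(E)` of the set `S = {v_0 : v ∈ E^0}` is all of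
`d_r(E)^0`. -/
theorem indelay_saturation_full
    {V E : Type} [Countable V] [Countable E] (r s : E → V)
    (d : V → ℕ∞) (dE : E → ℕ)
    (hsup : ∀ v, {e | r e = v}.Nonempty →
      d v = ⨆ e : {e // r e = v}, (dE e.1 : ℕ∞))
    (hinf : ∀ v, d v = ⊤ → ({e | r e = v} = ∅ ∨ {e | r e = v}.Infinite))
    (hrd : ∀ e, (dE e : ℕ∞) ≤ d (r e)) :
    SigmaH (idRng r d dE hrd) (idSrc s d)
      {w : IDVert d | ∃ v : V, w = idVert0 d v} = Set.univ := by
  exact Set.eq_univ_of_forall fun w =>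
    Set.mem_iUnion.2 ⟨w.1.2, idVert_mem_SigmaN r s d dE hrd w.1.1 w.1.2 w.2⟩
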